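/- Let τ>0, d∈ℕ, 0<α≤β<2, σ∈(0,1), λ>0, and let q₀:(0,τ]×ℝ^d×ℝ^d→ℝ be measurable and satisfy, for a constant c*≥1: |q₀(t,x,y)| ≤ c*·t^{−(d+β)/α}; |q₀(t,x,y)| ≤ c*·e^{−λ|x−y|} whenever |x−y|≥1; ∫_{ℝ^d}|q₀(t,x,u)|du ≤ c*·t^{−σ}; and ∫_{ℝ^d}|q₀(t,u,x)|du ≤ c*·t^{−σ}, for all t∈(0,τ], x,y∈ℝ^d. Define recursively q_n(t,x,y) = ∫₀ᵗ∫_{ℝ^d} q₀(t−s,x,z)·q_{n−1}(s,z,y)dzds. Then there are constants c₂>c₁≥c* such that for all n∈ℕ, t∈(0,τ], x,y∈ℝ^d: q_n(t,x,y) is well defined; ∫_{ℝ^d}|q_n(t,x,y)|dy ≤ c₁^{n+1}t^{(n+1)(1−σ)−1}/(n!)^{1−σ}; ∫_{ℝ^d}|q_n(t,y,x)|dy ≤ c₁^{n+1}t^{(n+1)(1−σ)−1}/(n!)^{1−σ}; |q_n(t,x,y)| ≤ c₁·c₂^n·t^{n(1−σ)−1}/((n!)^{1−σ}·t^{−1+(d+β)/α});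 and if |x−y|≥n+1 then |q_n(t,x,y)| ≤ c₁·c₂^n·t^{n(1−σ)}·e^{−λ|x−y|/(n+1)}/(n!)^{1−σ}. -/

import Mathlib

open MeasureTheory
lemma beta_lint (a b t : ℝ) (ha : 0 < a) (hb : 0 < b) (ht : 0 < t) :
    ∫⁻ s in Set.Ioc (0:ℝ) t, ENNReal.ofReal ((t - s) ^ (a - 1) * s ^ (b - 1))
      = ENNReal.ofReal (t ^ (a + b - 1) * ProbabilityTheory.beta b a) := by
  have hB := ProbabilityTheory.beta_pos hb ha
  have h1 := ProbabilityTheory.lintegral_betaPDF_eq_one hb ha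
  rw [ProbabilityTheory.lintegral_betaPDF] at h1
  have himg : (fun x : ℝ => t * x) '' Set.Ioo 0 1 = Set.Ioo 0 t := by
    rw [Set.image_mul_left_Ioo ht]; simp
  rw [setLIntegral_congr Ioo_ae_eq_Ioc.symm, ← himg,
    lintegral_image_eq_lintegral_abs_deriv_mul (f' := fun _ => t) measurableSet_Ioo
      (fun x _ => by simpa using ((hasDerivAt_id x).const_mul t).hasDerivWithinAt)
      (fun x _ y _ h => mul_left_cancel₀ ht.ne' h)]
  rw [← mul_one (ENNReal.ofReal (t ^ _ * _)), ← h1, ← lintegral_const_mul' _ _ (by simp)]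
  refine setLIntegral_congr_fun measurableSet_Ioo fun x hx => ?_
  have hx1 : 0 < 1 - x := by linarith [hx.2]
  have hx0 : 0 < x := hx.1
  rw [abs_of_pos ht, ← ENNReal.ofReal_mul ht.le, ← ENNReal.ofReal_mul (by positivity)]
  congr 1
  rw [show t - t * x = t * (1 - x) by ring, Real.mul_rpow ht.le hx1.le, Real.mul_rpow ht.le hx0.le,
    show a + b - 1 = 1 + (a - 1) + (b - 1) by ring, Real.rpow_add ht, Real.rpow_add ht, Real.rpow_one]
  field_simp

lemma beta_one (b : ℝ) (hb : 0 < b) : ProbabilityTheory.beta b 1 = 1 / b := by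
  have := Real.Gamma_pos_of_pos hb
  rw [ProbabilityTheory.beta, Real.Gamma_add_one hb.ne', Real.Gamma_one]
  field_simp

lemma pow_lint (b t : ℝ) (hb : 0 < b) (ht : 0 < t) :
    ∫⁻ s in Set.Ioc (0:ℝ) t, ENNReal.ofReal (s ^ (b - 1))
      = ENNReal.ofReal (t ^ b / b) := by
  have := beta_lint 1 b t one_pos hb ht
  simpa [beta_one b hb, div_eq_mul_inv] using this

lemma beta_bound (a : ℝ) (ha : 0 < a) (ha1 : a < 1) :
    ∃ C : ℝ, 0 < C ∧ ∀ n : ℕ, ProbabilityTheory.beta ((n + 1 : ℝ) * a) a ≤ C / (n + 1 : ℝ) ^ a := by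
  have hG := Real.Gamma_pos_of_pos ha
  refine ⟨Real.Gamma a * 2 / a ^ a, by positivity, fun n => ?_⟩
  have hn : (0:ℝ) < n + 1 := by positivity
  have hn1 : (1:ℝ) ≤ n + 1 := by linarith [Nat.cast_nonneg (α := ℝ) n]
  set b : ℝ := (n + 1 : ℝ) * a with hb
  have hb0 : 0 < b := by positivity
  have hab : a ≤ b := by rw [hb]; nlinarith
  have hGb := Real.Gamma_pos_of_pos hb0
  have hGab := Real.Gamma_pos_of_pos (add_pos hb0 ha)
  have h := Real.Gamma_mul_add_mul_le_rpow_Gamma_mul_rpow_Gamma (s := b + a) (t := b + a + 1)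
    (by positivity) (by positivity) ha (sub_pos.2 ha1) (by ring)
  rw [show a * (b + a) + (1 - a) * (b + a + 1) = b + 1 by ring, Real.Gamma_add_one hb0.ne',
    Real.Gamma_add_one (by positivity), Real.mul_rpow (by positivity) hGab.le, mul_left_comm,
    ← Real.rpow_add hGab, show a + (1 - a) = 1 by ring, Real.rpow_one] at h
  have h2 : (b + a) ^ (1 - a) ≤ 2 * b ^ (1 - a) := by
    calc (b + a) ^ (1 - a) ≤ (2 * b) ^ (1 - a) :=
          Real.rpow_le_rpow (by positivity) (by linarith) (by linarith)
      _ = 2 ^ (1 - a) * b ^ (1 - a) := Real.mul_rpow (by norm_num) hb0.le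
      _ ≤ 2 * b ^ (1 - a) := by
          gcongr
          calc (2:ℝ) ^ (1 - a) ≤ 2 ^ (1:ℝ) :=
                Real.rpow_le_rpow_of_exponent_le (by norm_num) (by linarith)
            _ = 2 := Real.rpow_one _
  rw [Real.rpow_sub hb0, Real.rpow_one] at h2
  have hba : (b:ℝ) ^ a = (n + 1 : ℝ) ^ a * a ^ a := Real.mul_rpow hn.le ha.le
  have hbap : 0 < b ^ a := by positivity
  rw [ProbabilityTheory.beta]
  have h3 : Real.Gamma b * b ^ a ≤ 2 * Real.Gamma (b + a) := by
    have : b * Real.Gamma b ≤ 2 * (b / b ^ a) * Real.Gamma (b + a) :=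
      h.trans (by gcongr)
    have h4 : b * (Real.Gamma b * b ^ a) ≤ b * (2 * Real.Gamma (b + a)) := by
      calc b * (Real.Gamma b * b ^ a) = (b * Real.Gamma b) * b ^ a := by ring
        _ ≤ (2 * (b / b ^ a) * Real.Gamma (b + a)) * b ^ a := by gcongr
        _ = _ := by field_simp
    exact le_of_mul_le_mul_left h4 hb0
  rw [div_div, mul_comm (a ^ a), ← hba, div_le_div_iff₀ hGab hbap]
  nlinarith

lemma exp_int (d : ℕ) (lam : ℝ) (hlam : 0 < lam) :
    Integrable (fun u : EuclideanSpace ℝ (Fin d) => Real.exp (-lam * ‖u‖)) := by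
  have h := integrable_one_add_norm (E := EuclideanSpace ℝ (Fin d)) (μ := volume)
    (r := ((d + 1 : ℕ) : ℝ)) (by simp)
  refine (h.const_mul ((Nat.factorial (d+1)) / lam ^ (d+1) * Real.exp lam)).mono' (by fun_prop) (ae_of_all _ fun u => ?_)
  rw [Real.norm_eq_abs, abs_of_pos (Real.exp_pos _), Real.rpow_neg (by positivity), Real.rpow_natCast]
  have hk := Real.pow_div_factorial_le_exp (lam * (1 + ‖u‖)) (by positivity) (d+1)
  have he : Real.exp (-lam * ‖u‖) = Real.exp lam * (Real.exp (lam * (1 + ‖u‖)))⁻¹ := by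
    rw [← Real.exp_neg, ← Real.exp_add]; congr 1; ring
  rw [he]
  calc Real.exp lam * (Real.exp (lam * (1 + ‖u‖)))⁻¹
      ≤ Real.exp lam * ((lam * (1 + ‖u‖)) ^ (d+1) / (Nat.factorial (d+1)))⁻¹ := by gcongr
    _ = _ := by rw [mul_pow]; field_simp

lemma swap3 {E : Type*} [MeasurableSpace E] (μ : Measure E) [SFinite μ] (t : ℝ)
    (F : ℝ → E → E → ENNReal) (hF : Measurable (fun p : ℝ × E × E => F p.1 p.2.1 p.2.2)) :
    ∫⁻ u, (∫⁻ s in Set.Ioc (0:ℝ) t, ∫⁻ z, F s z u ∂μ) ∂μ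
      = ∫⁻ s in Set.Ioc (0:ℝ) t, ∫⁻ z, ∫⁻ u, F s z u ∂μ ∂μ := by
  rw [lintegral_lintegral_swap]
  · refine lintegral_congr fun s => ?_
    rw [lintegral_lintegral_swap]
    exact (hF.comp (f := fun p : E × E => (s, p.2, p.1)) (by fun_prop)).aemeasurable
  · refine Measurable.aemeasurable ?_
    refine Measurable.lintegral_prod_right' (f := fun (q : (E × ℝ) × E) => F q.1.2 q.2 q.1.1) ?_
    exact hF.comp (f := fun q : (E × ℝ) × E => (q.1.2, q.2, q.1.1)) (by fun_prop)

lemma Ioc_bound (t : ℝ) (f g : ℝ → ENNReal) (h : ∀ s ∈ Set.Ioo 0 t, f s ≤ g s) :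
    ∫⁻ s in Set.Ioc (0:ℝ) t, f s ≤ ∫⁻ s in Set.Ioc (0:ℝ) t, g s := by
  rw [← setLIntegral_congr (f := f) Ioo_ae_eq_Ioc, ← setLIntegral_congr (f := g) Ioo_ae_eq_Ioc]
  exact setLIntegral_mono' measurableSet_Ioo h

lemma beta_lint' (a b t c D : ℝ) (ha : 0 < a) (hb : 0 < b) (ht : 0 < t) (hc : 0 ≤ c) (hD : 0 ≤ D) :
    ∫⁻ s in Set.Ioc (0:ℝ) t, ENNReal.ofReal (c * (t - s) ^ (a - 1)) * ENNReal.ofReal (D * s ^ (b - 1))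
      = ENNReal.ofReal (c * D * (t ^ (a + b - 1) * ProbabilityTheory.beta b a)) := by
  rw [ENNReal.ofReal_mul (by positivity : 0 ≤ c * D), ← beta_lint a b t ha hb ht,
    ← lintegral_const_mul' _ _ (by simp)]
  refine setLIntegral_congr_fun measurableSet_Ioc fun s hs => ?_
  have h0 : 0 ≤ t - s := by linarith [hs.2]
  have h1 : 0 ≤ s := hs.1.le
  rw [← ENNReal.ofReal_mul (by positivity), ← ENNReal.ofReal_mul (by positivity)]
  congr 1; ring

section
set_option linter.unusedSectionVars false
variable {E : Type*} [MeasurableSpace E] (μ : Measure E) [SFinite μ] (a b t c D : ℝ)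
    (ha : 0 < a) (hb : 0 < b) (ht : 0 < t) (hc : 0 ≤ c) (hD : 0 ≤ D)
    (f g : ℝ → E → E → ENNReal) (hf : Measurable (fun p : ℝ × E × E => f p.1 p.2.1 p.2.2))
    (hg : Measurable (fun p : ℝ × E × E => g p.1 p.2.1 p.2.2))
include ha hb ht hc hD hf hg

lemma conv1 (h1 : ∀ s, 0 < s → s < t → ∀ x, ∫⁻ u, f s x u ∂μ ≤ ENNReal.ofReal (c * s ^ (a - 1)))
    (h2 : ∀ s, 0 < s → s < t → ∀ x, ∫⁻ u, g s x u ∂μ ≤ ENNReal.ofReal (D * s ^ (b - 1))) (x : E) :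
    ∫⁻ u, (∫⁻ s in Set.Ioc (0:ℝ) t, ∫⁻ z, f (t - s) x z * g s z u ∂μ) ∂μ
      ≤ ENNReal.ofReal (c * D * (t ^ (a + b - 1) * ProbabilityTheory.beta b a)) := by
  rw [swap3 μ t (fun s z u => f (t - s) x z * g s z u), ← beta_lint' a b t c D ha hb ht hc hD]
  · refine Ioc_bound _ _ _ fun s hs => ?_
    calc ∫⁻ z, ∫⁻ u, f (t - s) x z * g s z u ∂μ ∂μ
        ≤ ∫⁻ z, f (t - s) x z * ENNReal.ofReal (D * s ^ (b - 1)) ∂μ := by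
          refine lintegral_mono fun z => ?_
          have hg' : Measurable fun u => g s z u :=
            hg.comp (f := fun u : E => (s, z, u)) (by fun_prop)
          rw [lintegral_const_mul _ hg']
          gcongr
          exact h2 s hs.1 hs.2 z
      _ ≤ _ := by
          rw [lintegral_mul_const' _ _ (by simp)]
          gcongr
          exact h1 (t - s) (by linarith [hs.2]) (by linarith [hs.1]) x
  · exact (hf.comp (f := fun p : ℝ × E × E => (t - p.1, x, p.2.1)) (by fun_prop)).mul hg

lemma conv2 (h1 : ∀ s, 0 < s → s < t → ∀ x, ∫⁻ u, f s u x ∂μ ≤ ENNReal.ofReal (c * s ^ (a - 1)))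
    (h2 : ∀ s, 0 < s → s < t → ∀ x, ∫⁻ u, g s u x ∂μ ≤ ENNReal.ofReal (D * s ^ (b - 1))) (y : E) :
    ∫⁻ u, (∫⁻ s in Set.Ioc (0:ℝ) t, ∫⁻ z, f (t - s) u z * g s z y ∂μ) ∂μ
      ≤ ENNReal.ofReal (c * D * (t ^ (a + b - 1) * ProbabilityTheory.beta b a)) := by
  rw [swap3 μ t (fun s z u => f (t - s) u z * g s z y), ← beta_lint' a b t c D ha hb ht hc hD]
  · refine Ioc_bound _ _ _ fun s hs => ?_
    calc ∫⁻ z, ∫⁻ u, f (t - s) u z * g s z y ∂μ ∂μ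
        ≤ ∫⁻ z, ENNReal.ofReal (c * (t - s) ^ (a - 1)) * g s z y ∂μ := by
          refine lintegral_mono fun z => ?_
          have hf' : Measurable fun u => f (t - s) u z :=
            hf.comp (f := fun u : E => (t - s, u, z)) (by fun_prop)
          rw [lintegral_mul_const _ hf']
          gcongr
          exact h1 (t - s) (by linarith [hs.2]) (by linarith [hs.1]) z
      _ ≤ _ := by
          rw [lintegral_const_mul' _ _ (by simp)]
          gcongr
          exact h2 s hs.1 hs.2 y
  · exact (hf.comp (f := fun p : ℝ × E × E => (t - p.1, p.2.2, p.2.1)) (by fun_prop)).mul 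
      (hg.comp (f := fun p : ℝ × E × E => (p.1, p.2.1, y)) (by fun_prop))

lemma conv3 (h1 : ∀ s, 0 < s → s < t → ∀ x, ∫⁻ u, f s x u ∂μ ≤ ENNReal.ofReal (c * s ^ (a - 1)))
    (h2 : ∀ s, 0 < s → s < t → ∀ x, ∫⁻ u, g s u x ∂μ ≤ ENNReal.ofReal (D * s ^ (b - 1)))
    (x y : E) (M₁ M₂ : ℝ) (hM₁ : 0 ≤ M₁) (hM₂ : 0 ≤ M₂)
    (hM : ∀ s, 0 < s → s < t → ∀ z, f (t - s) x z ≤ ENNReal.ofReal M₁ ∨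
      g s z y ≤ ENNReal.ofReal (M₂ * s ^ (b - 1))) :
    ∫⁻ s in Set.Ioc (0:ℝ) t, ∫⁻ z, f (t - s) x z * g s z y ∂μ
      ≤ ENNReal.ofReal (M₁ * (D * (t ^ b / b)) +
        c * M₂ * (t ^ (a + b - 1) * ProbabilityTheory.beta b a)) := by
  have hB := ProbabilityTheory.beta_pos hb ha
  rw [ENNReal.ofReal_add (by positivity) (by positivity), ← beta_lint' a b t c M₂ ha hb ht hc hM₂,
    ENNReal.ofReal_mul hM₁, ENNReal.ofReal_mul hD, ← pow_lint b t hb ht,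
    ← lintegral_const_mul' _ _ (by simp), ← lintegral_const_mul' _ _ (by simp),
    ← lintegral_add_left (by fun_prop)]
  refine Ioc_bound _ _ _ fun s hs => ?_
  have hg' : Measurable fun z => g s z y := hg.comp (f := fun z : E => (s, z, y)) (by fun_prop)
  calc ∫⁻ z, f (t - s) x z * g s z y ∂μ
      ≤ ∫⁻ z, (ENNReal.ofReal M₁ * g s z y +
          f (t - s) x z * ENNReal.ofReal (M₂ * s ^ (b - 1))) ∂μ := by
        refine lintegral_mono fun z => ?_
        rcases hM s hs.1 hs.2 z with h | h
        · exact le_add_right (by gcongr)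
        · exact le_add_left (by gcongr)
    _ ≤ _ := by
        rw [lintegral_add_left (hg'.const_mul _), lintegral_const_mul' _ _ (by simp),
          lintegral_mul_const' _ _ (by simp), ← ENNReal.ofReal_mul hD]
        gcongr
        · exact h2 s hs.1 hs.2 y
        · exact h1 (t - s) (by linarith [hs.2]) (by linarith [hs.1]) x
end

lemma real_step (a c₁ c₂ K C W X Y B b D M : ℝ) (n : ℕ) (ha : 0 < a) (ha1 : a < 1)
    (hC : 0 < C) (hc₁ : 0 < c₁) (hc : c₁ ≤ c₂) (hK : 0 ≤ K) (hKc : K * (1 / a + C) ≤ c₂) (hW : 0 ≤ W)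
    (hB0 : 0 ≤ B) (hBC : B ≤ C / (n + 1 : ℝ) ^ a) (hb : b = (n + 1 : ℝ) * a)
    (hD : D = c₁ ^ (n + 1) / (n.factorial : ℝ) ^ a)
    (hM : M = c₁ * c₂ ^ n / (n.factorial : ℝ) ^ a)
    (hX : X ≤ K * W) (hY : Y ≤ K * M * W) :
    X * (D / b) + Y * B ≤ c₁ * c₂ ^ (n + 1) / ((n + 1).factorial : ℝ) ^ a * W := by
  have hf : (0:ℝ) < n.factorial := by exact_mod_cast n.factorial_pos
  have hn1 : (1:ℝ) ≤ n + 1 := by linarith [Nat.cast_nonneg (α := ℝ) n]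
  have hfa : ((n + 1).factorial : ℝ) ^ a = (n + 1 : ℝ) ^ a * (n.factorial : ℝ) ^ a := by
    rw [Nat.factorial_succ]; push_cast
    exact Real.mul_rpow (by positivity) hf.le
  have hna : (n + 1 : ℝ) ^ a ≤ n + 1 := by
    calc (n + 1 : ℝ) ^ a ≤ (n + 1 : ℝ) ^ (1:ℝ) := Real.rpow_le_rpow_of_exponent_le hn1 ha1.le
      _ = _ := Real.rpow_one _
  have hc2 : 0 < c₂ := hc₁.trans_le hc
  have hM0 : 0 < M := by rw [hM]; positivity
  have hDM : D ≤ M := by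
    rw [hD, hM, pow_succ, mul_comm]
    gcongr
  have hD0 : 0 < D := by rw [hD]; positivity
  have hp : (0:ℝ) < (n + 1 : ℝ) ^ a := by positivity
  have hDb : D / b ≤ M / ((n + 1 : ℝ) ^ a * a) := by
    rw [hb]; gcongr
  have hDb0 : 0 ≤ D / b := by rw [hb]; positivity
  calc X * (D / b) + Y * B ≤ K * W * (M / ((n + 1 : ℝ) ^ a * a)) + K * M * W * (C / (n + 1 : ℝ) ^ a) := by
        gcongr
    _ = (K * (1 / a + C)) * (M * W / (n + 1 : ℝ) ^ a) := by field_simp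
    _ ≤ c₂ * (M * W / (n + 1 : ℝ) ^ a) := by gcongr
    _ = _ := by rw [hM, hfa, pow_succ]; field_simp



set_option maxHeartbeats 4000000 in
/-- inductive estimates for the iterated parametrix kernels `q_n` defined
by time-space convolution with the error kernel `q₀`. -/
theorem stmt_17 (d : ℕ) (τ α β σ lam cstar : ℝ)
    (hτ : 0 < τ) (hα : 0 < α) (hαβ : α ≤ β) (hβ : β < 2)
    (hσ0 : 0 < σ) (hσ1 : σ < 1) (hlam : 0 < lam) (hcstar : 1 ≤ cstar)
    (q₀ : ℝ → EuclideanSpace ℝ (Fin d) → EuclideanSpace ℝ (Fin d) → ℝ)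
    (hq₀meas : Measurable
      (fun p : ℝ × EuclideanSpace ℝ (Fin d) × EuclideanSpace ℝ (Fin d) =>
        q₀ p.1 p.2.1 p.2.2))
    (hb1 : ∀ t : ℝ, 0 < t → t ≤ τ → ∀ x y, |q₀ t x y| ≤ cstar * t ^ (-((d + β) / α)))
    (hb2 : ∀ t : ℝ, 0 < t → t ≤ τ → ∀ x y, 1 ≤ ‖x - y‖ →
      |q₀ t x y| ≤ cstar * Real.exp (-lam * ‖x - y‖))
    (hb3 : ∀ t : ℝ, 0 < t → t ≤ τ → ∀ x,
      (∫ u, |q₀ t x u|) ≤ cstar * t ^ (-σ))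
    (hb4 : ∀ t : ℝ, 0 < t → t ≤ τ → ∀ x,
      (∫ u, |q₀ t u x|) ≤ cstar * t ^ (-σ))
    (Q : ℕ → ℝ → EuclideanSpace ℝ (Fin d) → EuclideanSpace ℝ (Fin d) → ℝ)
    (hQmeas : ∀ n, Measurable
      (fun p : ℝ × EuclideanSpace ℝ (Fin d) × EuclideanSpace ℝ (Fin d) =>
        Q n p.1 p.2.1 p.2.2))
    (hQ0 : ∀ t x y, Q 0 t x y = q₀ t x y)
    (hQn : ∀ n : ℕ, ∀ t x y, Q (n + 1) t x y =
      ∫ s in Set.Ioc (0:ℝ) t, ∫ z, q₀ (t - s) x z * Q n s z y) :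
    ∃ c₁ c₂ : ℝ, cstar ≤ c₁ ∧ c₁ < c₂ ∧
      ∀ n : ℕ, ∀ t : ℝ, 0 < t → t ≤ τ → ∀ x y,
        -- q_{n+1} is well defined: the defining double integral converges
        Integrable
          (fun p : ℝ × EuclideanSpace ℝ (Fin d) => q₀ (t - p.1) x p.2 * Q n p.1 p.2 y)
          ((volume.restrict (Set.Ioc (0:ℝ) t)).prod volume) ∧
        (∫ u, |Q n t x u|) ≤
          c₁ ^ (n + 1) * t ^ ((n + 1 : ℝ) * (1 - σ) - 1) / (n.factorial : ℝ) ^ (1 - σ) ∧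
        (∫ u, |Q n t u y|) ≤
          c₁ ^ (n + 1) * t ^ ((n + 1 : ℝ) * (1 - σ) - 1) / (n.factorial : ℝ) ^ (1 - σ) ∧
        |Q n t x y| ≤ c₁ * c₂ ^ n * t ^ ((n : ℝ) * (1 - σ) - 1) /
          ((n.factorial : ℝ) ^ (1 - σ) * t ^ (-1 + (d + β) / α)) ∧
        ((n : ℝ) + 1 ≤ ‖x - y‖ →
          |Q n t x y| ≤ c₁ * c₂ ^ n * t ^ ((n : ℝ) * (1 - σ)) / (n.factorial : ℝ) ^ (1 - σ) *
            Real.exp (-lam * ‖x - y‖ / ((n : ℝ) + 1))) := by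
  have ha : 0 < 1 - σ := by linarith
  have ha1 : 1 - σ < 1 := by linarith
  have hσa : -σ = (1 - σ) - 1 := by ring
  rw [hσa] at hb3 hb4
  clear hσa
  generalize 1 - σ = a at *
  clear hσ0 hσ1
  have hκ : 1 ≤ ((d:ℝ) + β) / α := by
    rw [le_div_iff₀ hα]; linarith [Nat.cast_nonneg (α := ℝ) d]
  generalize ((d:ℝ) + β) / α = κ at *
  obtain ⟨C, hC, hBC⟩ := beta_bound a ha ha1
  have hc0 : 0 < cstar := by linarith
  have h2κ : (1:ℝ) ≤ 2 ^ κ := Real.one_le_rpow (by norm_num) (by linarith)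
  set K : ℝ := cstar * 2 ^ κ with hKdef
  have hK : 0 < K := by positivity
  have hcK : cstar ≤ K := by rw [hKdef]; nlinarith
  set c₁ : ℝ := cstar * (1 + C) with hc₁def
  have hc₁ : cstar ≤ c₁ := by rw [hc₁def]; nlinarith
  have hc₁0 : 0 < c₁ := by linarith
  have hcC : cstar * C ≤ c₁ := by rw [hc₁def]; nlinarith
  set c₂ : ℝ := c₁ + K * (1 / a + C) with hc₂def
  have hKpos : 0 < K * (1 / a + C) := by positivity
  have hc₁₂ : c₁ < c₂ := by linarith
  have hc₂0 : 0 < c₂ := by linarith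
  -- L1 bounds of the zeroth kernel
  have hdom : ∀ t : ℝ, 0 < t → t ≤ τ → ∀ x y, ‖q₀ t x y‖ ≤
      (cstar + cstar * t ^ (-κ) * Real.exp lam) * Real.exp (-lam * ‖x - y‖) := by
    intro t ht htτ x y
    rw [Real.norm_eq_abs]
    rcases le_or_gt 1 ‖x - y‖ with h | h
    · refine (hb2 t ht htτ x y h).trans ?_
      gcongr
      linarith [show 0 ≤ cstar * t ^ (-κ) * Real.exp lam by positivity]
    · refine (hb1 t ht htτ x y).trans ?_
      have h1 : 1 ≤ Real.exp lam * Real.exp (-lam * ‖x - y‖) := by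
        rw [← Real.exp_add]; apply Real.one_le_exp; nlinarith
      have h2 : 0 ≤ cstar * Real.exp (-lam * ‖x - y‖) := by positivity
      have h3 : 0 ≤ cstar * t ^ (-κ) := by positivity
      nlinarith
  have hqm1 : ∀ t x, Measurable fun u => q₀ t x u := fun t x =>
    hq₀meas.comp (f := fun u => (t, x, u)) (by fun_prop)
  have hqm2 : ∀ t x, Measurable fun u => q₀ t u x := fun t x =>
    hq₀meas.comp (f := fun u => (t, u, x)) (by fun_prop)
  have hI1 : ∀ t : ℝ, 0 < t → t ≤ τ → ∀ x, Integrable fun u => q₀ t x u := by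
    intro t ht htτ x
    refine Integrable.mono' (((exp_int d lam hlam).comp_sub_left x).const_mul
      (cstar + cstar * t ^ (-κ) * Real.exp lam)) (hqm1 t x).aestronglyMeasurable
      (ae_of_all _ fun u => hdom t ht htτ x u)
  have hI2 : ∀ t : ℝ, 0 < t → t ≤ τ → ∀ x, Integrable fun u => q₀ t u x := by
    intro t ht htτ x
    refine Integrable.mono' (((exp_int d lam hlam).comp_sub_right x).const_mul
      (cstar + cstar * t ^ (-κ) * Real.exp lam)) (hqm2 t x).aestronglyMeasurable
      (ae_of_all _ fun u => hdom t ht htτ u x)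
  have hL1 : ∀ t : ℝ, 0 < t → t ≤ τ → ∀ x,
      ∫⁻ u, ‖q₀ t x u‖ₑ ≤ ENNReal.ofReal (cstar * t ^ (a - 1)) := by
    intro t ht htτ x
    rw [← ofReal_integral_norm_eq_lintegral_enorm (hI1 t ht htτ x)]
    exact ENNReal.ofReal_le_ofReal (hb3 t ht htτ x)
  have hL2 : ∀ t : ℝ, 0 < t → t ≤ τ → ∀ x,
      ∫⁻ u, ‖q₀ t u x‖ₑ ≤ ENNReal.ofReal (cstar * t ^ (a - 1)) := by
    intro t ht htτ x
    rw [← ofReal_integral_norm_eq_lintegral_enorm (hI2 t ht htτ x)]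
    exact ENNReal.ofReal_le_ofReal (hb4 t ht htτ x)
  have hle : ∀ (r B : ℝ), |r| ≤ B → ‖r‖ₑ ≤ ENNReal.ofReal B := by
    intro r B h
    rw [← ofReal_norm]
    exact ENNReal.ofReal_le_ofReal h
  have hle' : ∀ (r B : ℝ), 0 ≤ B → ‖r‖ₑ ≤ ENNReal.ofReal B → |r| ≤ B := by
    intro r B hB h
    rw [← ofReal_norm] at h
    exact (ENNReal.ofReal_le_ofReal_iff hB).1 h
  have hfm : Measurable (fun p : ℝ × EuclideanSpace ℝ (Fin d) × EuclideanSpace ℝ (Fin d) =>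
        ‖q₀ p.1 p.2.1 p.2.2‖ₑ) := hq₀meas.enorm
  have hgm : ∀ n, Measurable (fun p : ℝ × EuclideanSpace ℝ (Fin d) × EuclideanSpace ℝ (Fin d) =>
        ‖Q n p.1 p.2.1 p.2.2‖ₑ) := fun n => (hQmeas n).enorm
  have hQle : ∀ n t x y, ‖Q (n + 1) t x y‖ₑ ≤
      ∫⁻ s in Set.Ioc (0:ℝ) t, ∫⁻ z, ‖q₀ (t - s) x z‖ₑ * ‖Q n s z y‖ₑ := by
    intro n t x y
    rw [hQn]
    refine (enorm_integral_le_lintegral_enorm _).trans (lintegral_mono fun s => ?_)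
    refine (enorm_integral_le_lintegral_enorm _).trans (lintegral_mono fun z => ?_)
    simp only [enorm_mul, le_refl]
  -- step for the sup bound
  have hstep3 : ∀ n : ℕ,
      (∀ t, 0 < t → t ≤ τ → ∀ y, ∫⁻ u, ‖Q n t u y‖ₑ ≤ ENNReal.ofReal
        (c₁ ^ (n + 1) / (n.factorial : ℝ) ^ a * t ^ ((n + 1 : ℝ) * a - 1))) →
      (∀ t, 0 < t → t ≤ τ → ∀ x y, |Q n t x y| ≤
        c₁ * c₂ ^ n / (n.factorial : ℝ) ^ a * t ^ ((n : ℝ) * a - κ)) →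
      ∀ t, 0 < t → t ≤ τ → ∀ x y,
      ∫⁻ s in Set.Ioc (0:ℝ) t, ∫⁻ z, ‖q₀ (t - s) x z‖ₑ * ‖Q n s z y‖ₑ ≤ ENNReal.ofReal
        (c₁ * c₂ ^ (n + 1) / ((n + 1).factorial : ℝ) ^ a * t ^ ((n + 1 : ℝ) * a - κ)) := by
    intro n h2 h3 t ht htτ x y
    have hf : (0:ℝ) < n.factorial := by exact_mod_cast n.factorial_pos
    have hb : 0 < (n + 1 : ℝ) * a := by positivity
    have ht2 : 0 < t / 2 := by positivity
    refine (conv3 volume a ((n + 1 : ℝ) * a) t cstar (c₁ ^ (n + 1) / (n.factorial : ℝ) ^ a)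
      ha hb ht hc0.le (by positivity) _ _ hfm (hgm n)
      (fun s hs hst => hL1 s hs (by linarith)) (fun s hs hst => h2 s hs (by linarith)) x y
      (cstar * (t / 2) ^ (-κ)) (c₁ * c₂ ^ n / (n.factorial : ℝ) ^ a * (t / 2) ^ (1 - κ - a))
      (by positivity) (by positivity) ?_).trans (ENNReal.ofReal_le_ofReal ?_)
    · intro s hs hst z
      rcases le_or_gt s (t / 2) with h | h
      · left
        refine hle _ _ ((hb1 (t - s) (by linarith) (by linarith) x z).trans ?_)
        gcongr ?_ * ?_
        exact Real.rpow_le_rpow_of_nonpos ht2 (by linarith) (by linarith)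
      · right
        refine hle _ _ ((h3 s hs (by linarith) z y).trans ?_)
        rw [mul_assoc _ ((t / 2) ^ (1 - κ - a))]
        gcongr ?_ * ?_
        rw [show (n : ℝ) * a - κ = (1 - κ - a) + ((n + 1 : ℝ) * a - 1) by ring, Real.rpow_add hs]
        gcongr ?_ * ?_
        exact Real.rpow_le_rpow_of_nonpos ht2 h.le (by linarith)
    · have hB := ProbabilityTheory.beta_pos hb ha
      have := real_step a c₁ c₂ K C (t ^ ((n + 1 : ℝ) * a - κ))
        (cstar * (t / 2) ^ (-κ) * t ^ ((n + 1 : ℝ) * a))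
        (cstar * (c₁ * c₂ ^ n / (n.factorial : ℝ) ^ a * (t / 2) ^ (1 - κ - a)) *
          t ^ (a + (n + 1 : ℝ) * a - 1))
        (ProbabilityTheory.beta ((n + 1 : ℝ) * a) a) ((n + 1 : ℝ) * a) _ _ n ha ha1 hC hc₁0
        hc₁₂.le hK.le (by linarith) (by positivity) hB.le (hBC n) rfl rfl rfl ?_ ?_
      · refine le_of_eq_of_le ?_ this
        ring
      · apply le_of_eq
        rw [Real.div_rpow ht.le (by norm_num), Real.rpow_neg (by norm_num : (0:ℝ) ≤ 2),
          sub_eq_add_neg, Real.rpow_add ht, hKdef]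
        field_simp
      · have e1 : (2:ℝ) ^ (κ + a - 1) ≤ 2 ^ κ :=
          Real.rpow_le_rpow_of_exponent_le (by norm_num) (by linarith)
        have e2 : (t / 2) ^ (1 - κ - a) = t ^ (1 - κ - a) * 2 ^ (κ + a - 1) := by
          rw [Real.div_rpow ht.le (by norm_num), show κ + a - 1 = -(1 - κ - a) by ring,
            Real.rpow_neg (by norm_num : (0:ℝ) ≤ 2)]
          field_simp
        have e3 : t ^ ((n + 1 : ℝ) * a - κ) = t ^ (1 - κ - a) * t ^ (a + (n + 1 : ℝ) * a - 1) := by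
          rw [← Real.rpow_add ht]; congr 1; ring
        rw [e2, e3, hKdef]
        calc _ = (cstar * 2 ^ (κ + a - 1)) * (c₁ * c₂ ^ n / (n.factorial : ℝ) ^ a) *
              (t ^ (1 - κ - a) * t ^ (a + (n + 1 : ℝ) * a - 1)) := by ring
          _ ≤ _ := by gcongr
  -- step for the exponential bound
  have hstep4 : ∀ n : ℕ,
      (∀ t, 0 < t → t ≤ τ → ∀ y, ∫⁻ u, ‖Q n t u y‖ₑ ≤ ENNReal.ofReal
        (c₁ ^ (n + 1) / (n.factorial : ℝ) ^ a * t ^ ((n + 1 : ℝ) * a - 1))) →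
      (∀ t, 0 < t → t ≤ τ → ∀ x y, (n : ℝ) + 1 ≤ ‖x - y‖ → |Q n t x y| ≤
        c₁ * c₂ ^ n / (n.factorial : ℝ) ^ a * t ^ ((n : ℝ) * a) *
          Real.exp (-lam * ‖x - y‖ / ((n : ℝ) + 1))) →
      ∀ t, 0 < t → t ≤ τ → ∀ x y, (n : ℝ) + 2 ≤ ‖x - y‖ →
      ∫⁻ s in Set.Ioc (0:ℝ) t, ∫⁻ z, ‖q₀ (t - s) x z‖ₑ * ‖Q n s z y‖ₑ ≤ ENNReal.ofReal
        (c₁ * c₂ ^ (n + 1) / ((n + 1).factorial : ℝ) ^ a * (t ^ ((n + 1 : ℝ) * a) *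
          Real.exp (-lam * ‖x - y‖ / ((n : ℝ) + 2)))) := by
    intro n h2 h4 t ht htτ x y hxy
    have hf : (0:ℝ) < n.factorial := by exact_mod_cast n.factorial_pos
    have hb : 0 < (n + 1 : ℝ) * a := by positivity
    have hn1 : (0:ℝ) < n + 1 := by positivity
    have hn2 : (0:ℝ) < n + 2 := by positivity
    refine (conv3 volume a ((n + 1 : ℝ) * a) t cstar (c₁ ^ (n + 1) / (n.factorial : ℝ) ^ a)
      ha hb ht hc0.le (by positivity) _ _ hfm (hgm n)
      (fun s hs hst => hL1 s hs (by linarith)) (fun s hs hst => h2 s hs (by linarith)) x y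
      (cstar * Real.exp (-lam * ‖x - y‖ / ((n : ℝ) + 2)))
      (c₁ * c₂ ^ n / (n.factorial : ℝ) ^ a * (t ^ (1 - a) *
        Real.exp (-lam * ‖x - y‖ / ((n : ℝ) + 2))))
      (by positivity) (by positivity) ?_).trans (ENNReal.ofReal_le_ofReal ?_)
    · intro s hs hst z
      have h1le : 1 ≤ ‖x - y‖ / (n + 2) := by rw [le_div_iff₀ hn2]; linarith
      rcases le_or_gt (‖x - y‖ / (n + 2)) ‖x - z‖ with h | h
      · left
        refine hle _ _ ((hb2 (t - s) (by linarith) (by linarith) x z (h1le.trans h)).trans ?_)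
        gcongr ?_ * ?_
        apply Real.exp_le_exp.2
        rw [mul_div_assoc]
        nlinarith
      · right
        have htri : ‖x - y‖ ≤ ‖x - z‖ + ‖z - y‖ := norm_sub_le_norm_sub_add_norm_sub x z y
        have hid : ‖x - y‖ = (n + 1) * (‖x - y‖ / (n + 2)) + ‖x - y‖ / (n + 2) := by
          field_simp; ring
        have hzy : (n + 1) * (‖x - y‖ / (n + 2)) ≤ ‖z - y‖ := by linarith
        refine hle _ _ ((h4 s hs (by linarith) z y (by nlinarith)).trans ?_)
        have hs1 : s ^ ((n : ℝ) * a) ≤ t ^ (1 - a) * s ^ ((n + 1 : ℝ) * a - 1) := by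
          rw [show (n : ℝ) * a = (1 - a) + ((n + 1 : ℝ) * a - 1) by ring, Real.rpow_add hs]
          gcongr
        have he : Real.exp (-lam * ‖z - y‖ / ((n : ℝ) + 1)) ≤
            Real.exp (-lam * ‖x - y‖ / ((n : ℝ) + 2)) := by
          apply Real.exp_le_exp.2
          rw [mul_div_assoc, mul_div_assoc]
          have : ‖x - y‖ / (n + 2) ≤ ‖z - y‖ / (n + 1) := by
            rw [le_div_iff₀ hn1]; linarith
          nlinarith
        calc _ ≤ c₁ * c₂ ^ n / (n.factorial : ℝ) ^ a * (t ^ (1 - a) * s ^ ((n + 1 : ℝ) * a - 1)) *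
              Real.exp (-lam * ‖x - y‖ / ((n : ℝ) + 2)) := by gcongr
          _ = _ := by ring
    · have hB := ProbabilityTheory.beta_pos hb ha
      set e : ℝ := Real.exp (-lam * ‖x - y‖ / ((n : ℝ) + 2)) with hedef
      have he0 : 0 < e := Real.exp_pos _
      have := real_step a c₁ c₂ K C (t ^ ((n + 1 : ℝ) * a) * e)
        (cstar * e * t ^ ((n + 1 : ℝ) * a))
        (cstar * (c₁ * c₂ ^ n / (n.factorial : ℝ) ^ a * (t ^ (1 - a) * e)) *
          t ^ (a + (n + 1 : ℝ) * a - 1))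
        (ProbabilityTheory.beta ((n + 1 : ℝ) * a) a) ((n + 1 : ℝ) * a) _ _ n ha ha1 hC hc₁0
        hc₁₂.le hK.le (by linarith) (by positivity) hB.le (hBC n) rfl rfl rfl ?_ ?_
      · refine le_of_eq_of_le ?_ this
        ring
      · calc _ = cstar * (t ^ ((n + 1 : ℝ) * a) * e) := by ring
          _ ≤ _ := by gcongr
      · have e3 : t ^ ((n + 1 : ℝ) * a) = t ^ (1 - a) * t ^ (a + (n + 1 : ℝ) * a - 1) := by
          rw [← Real.rpow_add ht]; congr 1; ring
        rw [e3]
        calc _ = cstar * (c₁ * c₂ ^ n / (n.factorial : ℝ) ^ a) *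
              (t ^ (1 - a) * t ^ (a + (n + 1 : ℝ) * a - 1) * e) := by ring
          _ ≤ _ := by gcongr
  -- arithmetic for the L1 steps
  have harith : ∀ n : ℕ, ∀ t : ℝ, 0 < t →
      cstar * (c₁ ^ (n + 1) / (n.factorial : ℝ) ^ a) * (t ^ (a + (n + 1 : ℝ) * a - 1) *
        ProbabilityTheory.beta ((n + 1 : ℝ) * a) a) ≤
      c₁ ^ (n + 1 + 1) / ((n + 1).factorial : ℝ) ^ a * t ^ (((n + 1 : ℕ) + 1 : ℝ) * a - 1) := by
    intro n t ht
    have hf : (0:ℝ) < n.factorial := by exact_mod_cast n.factorial_pos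
    have hfa : ((n + 1).factorial : ℝ) ^ a = (n + 1 : ℝ) ^ a * (n.factorial : ℝ) ^ a := by
      rw [Nat.factorial_succ]; push_cast
      exact Real.mul_rpow (by positivity) hf.le
    have hp : (0:ℝ) < (n + 1 : ℝ) ^ a := by positivity
    rw [show ((n + 1 : ℕ) + 1 : ℝ) * a - 1 = a + (n + 1 : ℝ) * a - 1 by push_cast; ring, hfa]
    calc _ ≤ cstar * (c₁ ^ (n + 1) / (n.factorial : ℝ) ^ a) * (t ^ (a + (n + 1 : ℝ) * a - 1) *
        (C / (n + 1 : ℝ) ^ a)) := by gcongr; exact hBC n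
      _ = (cstar * C) * (c₁ ^ (n + 1) / ((n + 1 : ℝ) ^ a * (n.factorial : ℝ) ^ a) *
            t ^ (a + (n + 1 : ℝ) * a - 1)) := by field_simp
      _ ≤ c₁ * (c₁ ^ (n + 1) / ((n + 1 : ℝ) ^ a * (n.factorial : ℝ) ^ a) *
            t ^ (a + (n + 1 : ℝ) * a - 1)) := by gcongr
      _ = _ := by rw [pow_succ c₁ (n + 1)]; ring
  have main : ∀ n : ℕ,
      (∀ t, 0 < t → t ≤ τ → ∀ x, ∫⁻ u, ‖Q n t x u‖ₑ ≤ ENNReal.ofReal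
        (c₁ ^ (n + 1) / (n.factorial : ℝ) ^ a * t ^ ((n + 1 : ℝ) * a - 1))) ∧
      (∀ t, 0 < t → t ≤ τ → ∀ y, ∫⁻ u, ‖Q n t u y‖ₑ ≤ ENNReal.ofReal
        (c₁ ^ (n + 1) / (n.factorial : ℝ) ^ a * t ^ ((n + 1 : ℝ) * a - 1))) ∧
      (∀ t, 0 < t → t ≤ τ → ∀ x y, |Q n t x y| ≤
        c₁ * c₂ ^ n / (n.factorial : ℝ) ^ a * t ^ ((n : ℝ) * a - κ)) ∧
      (∀ t, 0 < t → t ≤ τ → ∀ x y, (n : ℝ) + 1 ≤ ‖x - y‖ → |Q n t x y| ≤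
        c₁ * c₂ ^ n / (n.factorial : ℝ) ^ a * t ^ ((n : ℝ) * a) *
          Real.exp (-lam * ‖x - y‖ / ((n : ℝ) + 1))) := by
    intro n
    induction n with
    | zero =>
      simp only [hQ0]
      refine ⟨fun t ht htτ x => (hL1 t ht htτ x).trans (ENNReal.ofReal_le_ofReal ?_),
        fun t ht htτ x => (hL2 t ht htτ x).trans (ENNReal.ofReal_le_ofReal ?_),
        fun t ht htτ x y => (hb1 t ht htτ x y).trans ?_,
        fun t ht htτ x y hxy => (hb2 t ht htτ x y (by simpa using hxy)).trans ?_⟩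
      · simp; gcongr
      · simp; gcongr
      · simp; gcongr
      · simp; gcongr
    | succ n ih =>
      obtain ⟨i1, i2, i3, i4⟩ := ih
      have hf : (0:ℝ) < n.factorial := by exact_mod_cast n.factorial_pos
      have hf' : (0:ℝ) < (n + 1).factorial := by exact_mod_cast (n + 1).factorial_pos
      have hb : 0 < (n + 1 : ℝ) * a := by positivity
      refine ⟨fun t ht htτ x => ?_, fun t ht htτ y => ?_, fun t ht htτ x y => ?_,
        fun t ht htτ x y hxy => ?_⟩
      · refine (lintegral_mono fun u => hQle n t x u).trans
          ((conv1 volume a ((n + 1 : ℝ) * a) t cstar (c₁ ^ (n + 1) / (n.factorial : ℝ) ^ a)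
            ha hb ht hc0.le (by positivity) _ _ hfm (hgm n)
            (fun s hs hst => hL1 s hs (by linarith)) (fun s hs hst => i1 s hs (by linarith)) x).trans
          (ENNReal.ofReal_le_ofReal (harith n t ht)))
      · refine (lintegral_mono fun u => hQle n t u y).trans
          ((conv2 volume a ((n + 1 : ℝ) * a) t cstar (c₁ ^ (n + 1) / (n.factorial : ℝ) ^ a)
            ha hb ht hc0.le (by positivity) _ _ hfm (hgm n)
            (fun s hs hst => hL2 s hs (by linarith)) (fun s hs hst => i2 s hs (by linarith)) y).trans
          (ENNReal.ofReal_le_ofReal (harith n t ht)))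
      · refine hle' _ _ (by positivity) ((hQle n t x y).trans ?_)
        push_cast
        exact hstep3 n i2 i3 t ht htτ x y
      · refine hle' _ _ (by positivity) ((hQle n t x y).trans ?_)
        push_cast at hxy ⊢
        have e : (n:ℝ) + 1 + 1 = n + 2 := by ring
        rw [e] at hxy ⊢
        rw [mul_assoc]
        exact hstep4 n i2 i4 t ht htτ x y hxy
  refine ⟨c₁, c₂, hc₁, hc₁₂, fun n t ht htτ x y => ?_⟩
  obtain ⟨i1, i2, i3, i4⟩ := main n
  have hf : (0:ℝ) < n.factorial := by exact_mod_cast n.factorial_pos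
  have hint : ∀ (f : EuclideanSpace ℝ (Fin d) → ℝ) (B : ℝ), Measurable f → 0 ≤ B →
      ∫⁻ u, ‖f u‖ₑ ≤ ENNReal.ofReal B → ∫ u, |f u| ≤ B := by
    intro f B hf hB h
    have : ∫ u, |f u| = (∫⁻ u, ‖f u‖ₑ).toReal :=
      integral_norm_eq_lintegral_enorm hf.aestronglyMeasurable
    rw [this]
    exact ENNReal.toReal_le_of_le_ofReal hB h
  refine ⟨?_, ?_, ?_, ?_, ?_⟩
  · have hm : Measurable (fun p : ℝ × EuclideanSpace ℝ (Fin d) =>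
        q₀ (t - p.1) x p.2 * Q n p.1 p.2 y) :=
      (hq₀meas.comp (f := fun p : ℝ × EuclideanSpace ℝ (Fin d) => (t - p.1, x, p.2))
        (by fun_prop)).mul ((hQmeas n).comp
        (f := fun p : ℝ × EuclideanSpace ℝ (Fin d) => (p.1, p.2, y)) (by fun_prop))
    refine ⟨hm.aestronglyMeasurable, ?_⟩
    rw [hasFiniteIntegral_iff_enorm, lintegral_prod _ hm.enorm.aemeasurable]
    simp only [enorm_mul]
    exact (hstep3 n i2 i3 t ht htτ x y).trans_lt ENNReal.ofReal_lt_top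
  · refine hint _ _ ((hQmeas n).comp (f := fun u => (t, x, u)) (by fun_prop)) (by positivity)
      ((i1 t ht htτ x).trans (le_of_eq ?_))
    congr 1; ring
  · refine hint _ _ ((hQmeas n).comp (f := fun u => (t, u, y)) (by fun_prop)) (by positivity)
      ((i2 t ht htτ y).trans (le_of_eq ?_))
    congr 1; ring
  · refine (i3 t ht htτ x y).trans (le_of_eq ?_)
    rw [show (n : ℝ) * a - κ = ((n : ℝ) * a - 1) - (-1 + κ) by ring, Real.rpow_sub ht]
    field_simp
  · intro hxy
    refine (i4 t ht htτ x y hxy).trans (le_of_eq ?_)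
    ring
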